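/- arXiv:2308.02054 — 7 statements merged into one kernel-verified Lean document; each statement's English description precedes it below -/
import Mathlib

section
/- Let A be a measurable space, let m ≥ 1, let ξ_1, …, ξ_m be exchangeable A-valued random variables that are almost surely pairwise distinct, and let ψ : A^m → {1, …, m} be a ranking function. Then the random variable ψ(ξ_1, …, ξ_m) is uniformly distributed on {1, …, m}, i.e. P(ψ(ξ_1, …, ξ_m) = k) = 1/m for every k ∈ {1, …, m}. -/
open MeasureTheory ProbabilityTheory
open scoped ENNReal

/-- `ψ : A^m → {1, …, m}` is a ranking function: it takes values in `{1, …, m}`,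
it is invariant under permutations of its last `m − 1` arguments, and whenever
`a i ≠ a j`, the rank obtained by placing `a i` first (the remaining elements in the
other slots) differs from the rank obtained by placing `a j` first. -/
def IsRankingFunction {A : Type*} (m : ℕ) [NeZero m] (ψ : (Fin m → A) → ℕ) : Prop :=
  (∀ a : Fin m → A, ψ a ∈ Finset.Icc 1 m) ∧
  (∀ (a : Fin m → A) (τ : Equiv.Perm (Fin m)), τ 0 = 0 → ψ (a ∘ τ) = ψ a) ∧
  (∀ (a : Fin m → A) (i j : Fin m), a i ≠ a j →
    ψ (a ∘ Equiv.swap 0 i) ≠ ψ (a ∘ Equiv.swap 0 j))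

/-- On a tuple with distinct entries, every rank is attained by some entry. -/
theorem IsRankingFunction.exists_swap_eq {A : Type*} {m : ℕ} [NeZero m]
    {ψ : (Fin m → A) → ℕ} (hψ : IsRankingFunction m ψ) {a : Fin m → A}
    (ha : ∀ i j, i ≠ j → a i ≠ a j) {k : ℕ} (hk : k ∈ Finset.Icc 1 m) :
    ∃ i, ψ (a ∘ Equiv.swap 0 i) = k := by
  have hinj : Function.Injective fun i => ψ (a ∘ Equiv.swap 0 i) := by
    intro i j hij
    by_contra hne
    exact hψ.2.2 a i j (ha i j hne) hij
  have himage : Finset.univ.image (fun i => ψ (a ∘ Equiv.swap 0 i)) = Finset.Icc 1 m := by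
    apply Finset.eq_of_subset_of_card_le
    · exact Finset.image_subset_iff.2 fun i _ => hψ.1 _
    · simp [Finset.card_image_of_injective _ hinj]
  rw [← himage] at hk
  simpa using hk

/-- If `ξ 0, …, ξ (m−1)` are exchangeable, almost surely pairwise distinct random
variables with values in a measurable space `A` and `ψ` is a ranking function, then
`ψ (ξ 0, …, ξ (m−1))` is uniformly distributed on `{1, …, m}`. -/
theorem rankingFunction_uniform
    {Ω A : Type*} [MeasurableSpace Ω] [MeasurableSpace A]
    (P : Measure Ω) [IsProbabilityMeasure P]
    (m : ℕ) [NeZero m]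
    (ξ : Fin m → Ω → A) (hξmeas : ∀ i, Measurable (ξ i))
    (hexch : ∀ τ : Equiv.Perm (Fin m),
      Measure.map (fun ω (i : Fin m) => ξ (τ i) ω) P
        = Measure.map (fun ω (i : Fin m) => ξ i ω) P)
    (hdist : ∀ᵐ ω ∂P, ∀ i j : Fin m, i ≠ j → ξ i ω ≠ ξ j ω)
    (ψ : (Fin m → A) → ℕ) (hψmeas : Measurable ψ)
    (hψ : IsRankingFunction m ψ) :
    ∀ k ∈ Finset.Icc 1 m, P {ω | ψ (fun i => ξ i ω) = k} = (m : ℝ≥0∞)⁻¹ := by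
  intro k hk
  let E : Fin m → Set Ω := fun i => {ω | ψ (fun j => ξ (Equiv.swap 0 i j) ω) = k}
  have hmeas (τ : Equiv.Perm (Fin m)) : Measurable fun ω (j : Fin m) => ξ (τ j) ω :=
    measurable_pi_lambda _ fun j => hξmeas (τ j)
  have hS : MeasurableSet (ψ ⁻¹' {k}) := hψmeas (measurableSet_singleton k)
  have hE (i : Fin m) : P (E i) = P {ω | ψ (fun j => ξ j ω) = k} := by
    have h := congrArg (fun μ => μ (ψ ⁻¹' {k})) (hexch (Equiv.swap 0 i))
    simp only [Measure.map_apply (hmeas (Equiv.swap 0 i)) hS,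
      Measure.map_apply (measurable_pi_lambda _ hξmeas) hS] at h
    exact h
  have hdisj : Pairwise (Function.onFun (AEDisjoint P) E) := by
    intro i j hij
    refine measure_mono_null ?_ (ae_iff.1 hdist)
    rintro ω ⟨hi, hj⟩ hω
    exact hψ.2.2 (fun l => ξ l ω) i j (hω i j hij) (hi.trans hj.symm)
  have hunion : P (⋃ i, E i) = 1 := by
    rw [← measure_univ (μ := P)]
    apply measure_congr
    rw [ae_eq_univ, ← nonpos_iff_eq_zero, ← ae_iff.1 hdist]
    apply measure_mono
    intro ω hω hd
    exact hω (Set.mem_iUnion.2 (hψ.exists_swap_eq hd hk))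
  rw [measure_iUnion₀ hdisj
    fun i => ((hmeas (Equiv.swap 0 i)) hS : MeasurableSet (E i)).nullMeasurableSet] at hunion
  simp only [hE, tsum_fintype, Finset.sum_const, Finset.card_univ, Fintype.card_fin,
    nsmul_eq_mul] at hunion
  exact ENNReal.eq_inv_of_mul_eq_one_left ((mul_comm _ _).trans hunion)
end

section
/- Let A be a measurable space, let ξ_1, …, ξ_m be exchangeable A-valued random variables that are almost surely pairwise distinct, and let ψ : A^m → {1, …, m} be a ranking function. Then for all integers 1 ≤ r ≤ p ≤ m: P(r ≤ ψ(ξ_1, …, ξ_m) ≤ p) = (p − r + 1)/m. -/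
open MeasureTheory ProbabilityTheory
open scoped ENNReal

/-- Placing the entries of an injective tuple in front one after the other attains every rank
exactly once. -/
theorem IsRankingFunction.card_filter_mem {A : Type*} {m : ℕ} [NeZero m] {ψ : (Fin m → A) → ℕ}
    (hψ : IsRankingFunction m ψ) {a : Fin m → A} (ha : Function.Injective a)
    {S : Finset ℕ} (hS : S ⊆ Finset.Icc 1 m) :
    (Finset.univ.filter fun i : Fin m => ψ (a ∘ Equiv.swap 0 i) ∈ S).card = S.card := by
  have hinj : Function.Injective fun i : Fin m => ψ (a ∘ Equiv.swap 0 i) := by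
    intro i j hij
    by_contra hne
    exact hψ.2.2 a i j (fun h => hne (ha h)) hij
  have himage : Finset.univ.image (fun i : Fin m => ψ (a ∘ Equiv.swap 0 i)) = Finset.Icc 1 m := by
    apply Finset.eq_of_subset_of_card_le
    · intro k hk
      obtain ⟨i, -, rfl⟩ := Finset.mem_image.mp hk
      exact hψ.1 _
    · simp [Finset.card_image_of_injective _ hinj]
  rw [← Finset.card_image_of_injective _ hinj]
  congr 1
  ext k
  simp only [Finset.mem_image, Finset.mem_filter, Finset.mem_univ, true_and]
  constructor
  · rintro ⟨i, hi, rfl⟩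
    exact hi
  · intro hk
    obtain ⟨i, -, rfl⟩ := Finset.mem_image.mp (himage ▸ hS hk)
    exact ⟨i, hk, rfl⟩

/-- The rank of the first of finitely many exchangeable, almost surely pairwise distinct random
variables is uniformly distributed. -/
theorem IsRankingFunction.measure_mem {Ω A : Type*} [MeasurableSpace Ω] [MeasurableSpace A]
    {P : Measure Ω} [IsProbabilityMeasure P] {m : ℕ} [NeZero m]
    {ξ : Fin m → Ω → A} (hξmeas : ∀ i, Measurable (ξ i))
    (hexch : ∀ τ : Equiv.Perm (Fin m),
      Measure.map (fun ω (i : Fin m) => ξ (τ i) ω) P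
        = Measure.map (fun ω (i : Fin m) => ξ i ω) P)
    (hdist : ∀ᵐ ω ∂P, ∀ i j : Fin m, i ≠ j → ξ i ω ≠ ξ j ω)
    {ψ : (Fin m → A) → ℕ} (hψmeas : Measurable ψ) (hψ : IsRankingFunction m ψ)
    {S : Finset ℕ} (hS : S ⊆ Finset.Icc 1 m) :
    P {ω | ψ (fun i => ξ i ω) ∈ S} = (S.card : ℝ≥0∞) / (m : ℝ≥0∞) := by
  have hm : MeasurableSet (ψ ⁻¹' (S : Set ℕ)) := hψmeas S.measurableSet
  have hpi (τ : Equiv.Perm (Fin m)) : Measurable fun ω (i : Fin m) => ξ (τ i) ω :=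
    measurable_pi_lambda _ fun i => hξmeas (τ i)
  let E : Fin m → Set Ω := fun j => {ω | ψ (fun i => ξ (Equiv.swap 0 j i) ω) ∈ S}
  have hE (j : Fin m) : MeasurableSet (E j) := hpi _ hm
  have hPE (j : Fin m) : P (E j) = P {ω | ψ (fun i => ξ i ω) ∈ S} := by
    have h := congrArg (fun μ => μ (ψ ⁻¹' (S : Set ℕ))) (hexch (Equiv.swap 0 j))
    simp only [Measure.map_apply (hpi _) hm] at h
    rw [Measure.map_apply (measurable_pi_lambda _ hξmeas) hm] at h
    exact h
  have hcount : ∀ᵐ ω ∂P, ∑ j, (E j).indicator (1 : Ω → ℝ≥0∞) ω = (S.card : ℝ≥0∞) := by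
    filter_upwards [hdist] with ω hω
    have ha : Function.Injective fun i => ξ i ω := fun i j hij => by
      by_contra hne
      exact hω i j hne hij
    rw [← hψ.card_filter_mem ha hS, Finset.card_filter, Nat.cast_sum]
    refine Finset.sum_congr rfl fun j _ => ?_
    simp [E, Set.indicator_apply, Function.comp_def]
  have hsum : (m : ℝ≥0∞) * P {ω | ψ (fun i => ξ i ω) ∈ S} = S.card := by
    calc (m : ℝ≥0∞) * P {ω | ψ (fun i => ξ i ω) ∈ S} = ∑ j, P (E j) := by simp [hPE]
      _ = ∑ j, ∫⁻ ω, (E j).indicator (1 : Ω → ℝ≥0∞) ω ∂P := by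
        simp only [lintegral_indicator_one (hE _)]
      _ = ∫⁻ ω, ∑ j, (E j).indicator (1 : Ω → ℝ≥0∞) ω ∂P :=
        (lintegral_finsetSum _ fun j _ => measurable_one.indicator (hE j)).symm
      _ = S.card := by simp [lintegral_congr_ae hcount]
  rw [ENNReal.eq_div_iff (by exact_mod_cast NeZero.ne m) (ENNReal.natCast_ne_top m), hsum]

/-- If `ξ 0, …, ξ (m−1)` are exchangeable, almost surely pairwise distinct random
variables with values in a measurable space `A` and `ψ` is a ranking function, then
for all integers `1 ≤ r ≤ p ≤ m` one has
`P(r ≤ ψ (ξ 0, …, ξ (m−1)) ≤ p) = (p − r + 1) / m`. -/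
theorem rankingFunction_interval_prob
    {Ω A : Type*} [MeasurableSpace Ω] [MeasurableSpace A]
    (P : Measure Ω) [IsProbabilityMeasure P]
    (m : ℕ) [NeZero m]
    (ξ : Fin m → Ω → A) (hξmeas : ∀ i, Measurable (ξ i))
    (hexch : ∀ τ : Equiv.Perm (Fin m),
      Measure.map (fun ω (i : Fin m) => ξ (τ i) ω) P
        = Measure.map (fun ω (i : Fin m) => ξ i ω) P)
    (hdist : ∀ᵐ ω ∂P, ∀ i j : Fin m, i ≠ j → ξ i ω ≠ ξ j ω)
    (ψ : (Fin m → A) → ℕ) (hψmeas : Measurable ψ)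
    (hψ : IsRankingFunction m ψ) :
    ∀ r p : ℕ, 1 ≤ r → r ≤ p → p ≤ m →
      P {ω | r ≤ ψ (fun i => ξ i ω) ∧ ψ (fun i => ξ i ω) ≤ p}
        = ((p - r + 1 : ℕ) : ℝ≥0∞) / (m : ℝ≥0∞) := by
  intro r p hr hrp hpm
  have h := hψ.measure_mem hξmeas hexch hdist hψmeas (S := Finset.Icc r p)
    (Finset.Icc_subset_Icc hr hpm)
  simpa only [Finset.mem_Icc, Nat.card_Icc, Nat.sub_add_comm hrp] using h
end

section
/- Let A be a measurable space, let X_0, …, X_{m−1} be exchangeable A-valued random variables, and let σ be a uniformly distributed random permutation of {0, …, m−1} that is independent of (X_0, …, X_{m−1}). Then the augmented random variables (X_0, σ(0)), (X_1, σ(1)), …, (X_{m−1}, σ(m−1)), taking values in A × {0, …, m−1}, are exchangeable and almost surely pairwise distinct. -/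
open MeasureTheory ProbabilityTheory
open scoped ENNReal

/-- We endow the (finite) group of permutations of `Fin m` with the discrete
measurable structure. -/
instance : ∀ m : ℕ, MeasurableSpace (Equiv.Perm (Fin m)) := fun _ => ⊤

/-- A random permutation that takes every value with the same probability has the same law as
its composition with a deterministic permutation. -/
theorem map_mul_right_perm_eq_of_const_prob {Ω : Type*} [MeasurableSpace Ω] {P : Measure Ω}
    {m : ℕ} {σ : Ω → Equiv.Perm (Fin m)} (hσ : Measurable σ) {c : ℝ≥0∞}
    (hc : ∀ ρ, P {ω | σ ω = ρ} = c) (τ : Equiv.Perm (Fin m)) :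
    Measure.map (fun ω => σ ω * τ) P = Measure.map σ P := by
  have : MeasurableSingletonClass (Equiv.Perm (Fin m)) := ⟨fun _ => trivial⟩
  refine Measure.ext_of_singleton fun ρ => ?_
  have hστ : Measurable fun ω => σ ω * τ := (measurable_from_top (f := (· * τ))).comp hσ
  rw [Measure.map_apply hστ (measurableSet_singleton ρ),
    Measure.map_apply hσ (measurableSet_singleton ρ)]
  have hpre : (fun ω => σ ω * τ) ⁻¹' {ρ} = {ω | σ ω = ρ * τ⁻¹} := by
    ext ω
    simp [eq_mul_inv_iff_mul_eq]
  rw [hpre, hc]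
  exact (hc ρ).symm

/-- If `X 0, …, X (m−1)` are exchangeable random variables with values in a measurable
space `A` and `σ` is a uniformly distributed random permutation of `{0, …, m−1}`
independent of `(X 0, …, X (m−1))`, then the augmented random variables
`ω ↦ (X i ω, σ ω i)`, with values in `A × Fin m`, are exchangeable and almost surely
pairwise distinct. -/
theorem augmented_variables_exchangeable_distinct
    {Ω A : Type*} [MeasurableSpace Ω] [MeasurableSpace A]
    (P : Measure Ω) [IsProbabilityMeasure P]
    (m : ℕ)
    (X : Fin m → Ω → A) (hXmeas : ∀ i, Measurable (X i))
    (hexch : ∀ τ : Equiv.Perm (Fin m),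
      Measure.map (fun ω (i : Fin m) => X (τ i) ω) P
        = Measure.map (fun ω (i : Fin m) => X i ω) P)
    (σ : Ω → Equiv.Perm (Fin m)) (hσmeas : Measurable σ)
    (hσunif : ∀ τ : Equiv.Perm (Fin m),
      P {ω | σ ω = τ} = ((Nat.factorial m : ℝ≥0∞))⁻¹)
    (hindep : IndepFun (fun ω (i : Fin m) => X i ω) σ P) :
    (∀ τ : Equiv.Perm (Fin m),
      Measure.map (fun ω (i : Fin m) => (X (τ i) ω, σ ω (τ i))) P
        = Measure.map (fun ω (i : Fin m) => (X i ω, σ ω i)) P) ∧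
    (∀ᵐ ω ∂P, ∀ i j : Fin m, i ≠ j → (X i ω, σ ω i) ≠ (X j ω, σ ω j)) := by
  refine ⟨fun τ => ?_, .of_forall fun ω i j hij h => hij ((σ ω).injective (Prod.ext_iff.mp h).2)⟩
  have hX : Measurable fun ω i => X i ω := measurable_pi_lambda _ hXmeas
  have hreindex : Measurable fun (x : Fin m → A) i => x (τ i) := by fun_prop
  have hmul : Measurable fun s : Equiv.Perm (Fin m) => s * τ := measurable_from_top
  have hXτ : Measurable fun ω i => X (τ i) ω := hreindex.comp hX
  have hστ : Measurable fun ω => σ ω * τ := hmul.comp hσmeas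
  have hindepτ : IndepFun (fun ω i => X (τ i) ω) (fun ω => σ ω * τ) P :=
    hindep.comp hreindex hmul
  have hjoint : Measure.map (fun ω => ((fun i => X (τ i) ω), σ ω * τ)) P
      = Measure.map (fun ω => ((fun i => X i ω), σ ω)) P := by
    rw [(indepFun_iff_map_prod_eq_prod_map_map hXτ.aemeasurable hστ.aemeasurable).mp hindepτ,
      (indepFun_iff_map_prod_eq_prod_map_map hX.aemeasurable hσmeas.aemeasurable).mp hindep,
      hexch τ, map_mul_right_perm_eq_of_const_prob hσmeas hσunif τ]
  have hpair : Measurable fun (p : (Fin m → A) × Equiv.Perm (Fin m)) i => (p.1 i, p.2 i) :=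
    measurable_pi_lambda _ fun i => ((measurable_pi_apply i).comp measurable_fst).prodMk
      ((measurable_from_top (f := fun s : Equiv.Perm (Fin m) => s i)).comp measurable_snd)
  have := congrArg (Measure.map fun p i => (p.1 i, p.2 i)) hjoint
  rwa [Measure.map_map hpair (hXτ.prodMk hστ), Measure.map_map hpair (hX.prodMk hσmeas)] at this
end

section
/- Let (Ω, F, P) be a probability space, let Θ and Γ be sets with distinguished elements θ* ∈ Θ and γ* ∈ Γ, let m ≥ 1 and 1 ≤ r ≤ m be integers, and let β ∈ (0, 1). For each (θ, γ) ∈ Θ × Γ let R(θ, γ) : Ω → {1, …, m} be a random rank, and let Θ̂ : Ω → Set(Θ) and Γ̂ : Ω → Set(Γ) be random sets. Assume: P(R(θ*, γ*) ≤ r) = r/m; P(θ* ∈ Θ̂) ≥ 1 − β; P(γ* ∈ Γ̂) ≥ 1 − β; and the event A = {ω : for all θ ∈ Θ̂(ω) and γ ∈ Γ̂(ω), R(θ, γ)(ω) ≤ r} is measurable (as are the events {θ* ∈ Θ̂}, {γ* ∈ Γ̂}, {R(θ*,γ*) ≤ r}). Then P(A) ≤ r/m + 2β. -/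
open MeasureTheory
open scoped ENNReal

/-- An event of probability at least `1 - β` fails with probability at most `β`. -/
lemma measure_compl_le_of_one_sub_le {Ω : Type*} [MeasurableSpace Ω] {P : Measure Ω}
    [IsProbabilityMeasure P] {s : Set Ω} (hs : MeasurableSet s) {β : ℝ≥0∞}
    (h : 1 - β ≤ P s) : P sᶜ ≤ β := by
  rw [prob_compl_eq_one_sub hs]
  exact tsub_le_iff_tsub_le.mp h

/-- Robust test significance level bound.  If the rank at the true parameters satisfies
`P(R(θ*, γ*) ≤ r) = r/m` and the confidence regions `Θ̂`, `Γ̂` cover `θ*`, `γ*` with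
probability at least `1 − β` each, then the probability of rejection, i.e. of the event
that `R(θ, γ) ≤ r` simultaneously for all parameters in `Θ̂ × Γ̂`, is at most
`r/m + 2β`. -/
theorem robust_test_level_bound
    {Ω : Type*} [MeasurableSpace Ω] (P : Measure Ω) [IsProbabilityMeasure P]
    {Θ Γ : Type*} (θs : Θ) (γs : Γ)
    (m r : ℕ) (hm : 1 ≤ m) (hr1 : 1 ≤ r) (hrm : r ≤ m)
    (β : ℝ≥0∞) (hβ0 : 0 < β) (hβ1 : β < 1)
    (R : Θ → Γ → Ω → ℕ) (hRrange : ∀ θ γ ω, R θ γ ω ∈ Finset.Icc 1 m)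
    (That : Ω → Set Θ) (Ghat : Ω → Set Γ)
    (hRmeas : MeasurableSet {ω | R θs γs ω ≤ r})
    (hTmeas : MeasurableSet {ω | θs ∈ That ω})
    (hGmeas : MeasurableSet {ω | γs ∈ Ghat ω})
    (hAmeas : MeasurableSet {ω | ∀ θ ∈ That ω, ∀ γ ∈ Ghat ω, R θ γ ω ≤ r})
    (hR : P {ω | R θs γs ω ≤ r} = (r : ℝ≥0∞) / (m : ℝ≥0∞))
    (hT : 1 - β ≤ P {ω | θs ∈ That ω})
    (hG : 1 - β ≤ P {ω | γs ∈ Ghat ω}) :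
    P {ω | ∀ θ ∈ That ω, ∀ γ ∈ Ghat ω, R θ γ ω ≤ r}
      ≤ (r : ℝ≥0∞) / (m : ℝ≥0∞) + 2 * β := by
  have hsub : {ω | ∀ θ ∈ That ω, ∀ γ ∈ Ghat ω, R θ γ ω ≤ r} ⊆
      {ω | R θs γs ω ≤ r} ∪ ({ω | θs ∈ That ω}ᶜ ∪ {ω | γs ∈ Ghat ω}ᶜ) := by
    intro ω hω
    by_cases hθ : θs ∈ That ω
    · by_cases hγ : γs ∈ Ghat ω
      · exact Or.inl (hω θs hθ γs hγ)
      · exact Or.inr (Or.inr hγ)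
    · exact Or.inr (Or.inl hθ)
  calc P {ω | ∀ θ ∈ That ω, ∀ γ ∈ Ghat ω, R θ γ ω ≤ r}
      ≤ P {ω | R θs γs ω ≤ r} + (P {ω | θs ∈ That ω}ᶜ + P {ω | γs ∈ Ghat ω}ᶜ) :=
        (measure_mono hsub).trans <| (measure_union_le _ _).trans <| by
          gcongr
          exact measure_union_le _ _
    _ ≤ (r : ℝ≥0∞) / (m : ℝ≥0∞) + (β + β) := by
        rw [hR]
        gcongr
        · exact measure_compl_le_of_one_sub_le hTmeas hT
        · exact measure_compl_le_of_one_sub_le hGmeas hG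
    _ = (r : ℝ≥0∞) / (m : ℝ≥0∞) + 2 * β := by rw [two_mul]
end

section
/- Let θ* ∈ ℝ^{d1}, γ* ∈ ℝ^{d2}, m ≥ 1, and for each n and each j ∈ {0, 1, …, m−1} let Δ_n^{(j)} : ℝ^{d1} × ℝ^{d2} × Ω → [0, ∞) be a random field on a probability space Ω, and let Θ̂_n : Ω → Set(ℝ^{d1}), Γ̂_n : Ω → Set(ℝ^{d2}) be random sets. Assume: (i) Δ_n^{(0)}(θ*, γ*) converges in probability to a constant κ > 0 and Δ_n^{(j)}(θ*, γ*) converges in probability to 0 for each j ∈ {1, …, m−1}; (ii) almost surely there exist constants C > 0 and ε̃ > 0 such that for all n, all j ∈ {0, …, m−1}, and all (θ, γ) with ‖θ − θ*‖ ≤ ε̃ and ‖γ − γ*‖ ≤ ε̃: |Δ_n^{(j)}(θ, γ) − Δ_n^{(j)}(θ*, γ*)| ≤ C(‖θ − θ*‖ + ‖γ − γ*‖); (iii) the confidence sets are uniformly consistent: for every ε > 0, almost surely there exists N_0 such that for all n > N_0, Θ̂_n ⊆ B(θ*, ε) and Γ̂_n ⊆ B(γ*, ε); (iv) the events below are measurable.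 Define R_n(θ, γ) = 1 + #{j ∈ {1, …, m−1} : Δ_n^{(0)}(θ, γ) ≤ Δ_n^{(j)}(θ, γ)}. Then for every integer r ≥ 1, P(for all (θ, γ) ∈ Θ̂_n × Γ̂_n : R_n(θ, γ) ≤ r) → 1 as n → ∞. -/
open MeasureTheory Filter
open scoped ENNReal Topology

/-- The rank statistic `1 + #{j ∈ {1, …, m−1} : f 0 ≤ f j}` of the reference value
`f 0` among the values `f 1, …, f (m−1)`. -/
noncomputable def rankStat {m : ℕ} [NeZero m] (f : Fin m → ℝ) : ℕ :=
  1 + (Finset.univ.filter (fun j : Fin m => j ≠ 0 ∧ f 0 ≤ f j)).card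

/-- Measurable sets that almost every point eventually leaves have measure tending to `0`. -/
theorem tendsto_measure_zero_of_ae_eventually_notMem {Ω : Type*} [MeasurableSpace Ω]
    (P : Measure Ω) [IsFiniteMeasure P] {F : ℕ → Set Ω} (hF : ∀ n, MeasurableSet (F n))
    (h : ∀ᵐ ω ∂P, ∀ᶠ n in atTop, ω ∉ F n) :
    Tendsto (fun n => P (F n)) atTop (𝓝 0) := by
  rw [← measure_empty (μ := P)]
  refine tendsto_measure_of_ae_tendsto_indicator_of_isFiniteMeasure atTop MeasurableSet.empty hF ?_
  filter_upwards [h] with ω hω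
  filter_upwards [hω] with n hn
  simp [hn]

/-- If measurable sets `E n` contain, eventually for almost every point, the complement of
(possibly nonmeasurable) sets `A n` of vanishing measure, their probability tends to `1`. -/
theorem tendsto_measure_one_of_ae_eventually_mem {Ω : Type*} [MeasurableSpace Ω]
    (P : Measure Ω) [IsProbabilityMeasure P] {E A : ℕ → Set Ω}
    (hE : ∀ n, MeasurableSet (E n)) (hA : Tendsto (fun n => P (A n)) atTop (𝓝 0))
    (h : ∀ᵐ ω ∂P, ∀ᶠ n in atTop, ω ∉ A n → ω ∈ E n) :
    Tendsto (fun n => P (E n)) atTop (𝓝 1) := by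
  have hF : Tendsto (fun n => P ((E n)ᶜ \ toMeasurable P (A n))) atTop (𝓝 0) := by
    refine tendsto_measure_zero_of_ae_eventually_notMem P
      (fun n => (hE n).compl.diff (measurableSet_toMeasurable _ _)) ?_
    filter_upwards [h] with ω hω
    filter_upwards [hω] with n hn hmem
    exact hmem.1 (hn fun hωA => hmem.2 (subset_toMeasurable _ _ hωA))
  have hcompl : Tendsto (fun n => P (E n)ᶜ) atTop (𝓝 0) := by
    refine tendsto_of_tendsto_of_tendsto_of_le_of_le tendsto_const_nhds
      (by simpa using hF.add hA) (fun _ => zero_le) fun n => ?_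
    calc P (E n)ᶜ ≤ P (((E n)ᶜ \ toMeasurable P (A n)) ∪ toMeasurable P (A n)) :=
          measure_mono (by simp)
      _ ≤ _ := (measure_union_le _ _).trans_eq (by rw [measure_toMeasurable])
  have hsub := ENNReal.Tendsto.sub (tendsto_const_nhds (x := (1 : ℝ≥0∞))) hcompl (by simp)
  simpa [← prob_compl_eq_one_sub (hE _).compl] using hsub

theorem rankStat_eq_one {m : ℕ} [NeZero m] {f : Fin m → ℝ} (h : ∀ j ≠ 0, f j < f 0) :
    rankStat f = 1 := by
  simpa [rankStat, Finset.filter_eq_empty_iff] using h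

/-- Strong consistency of the robust independence test: if the dependence measure
estimates at the true parameters separate (`Δ n 0 (θ*, γ*) → κ > 0` in probability and
`Δ n j (θ*, γ*) → 0` in probability for `j ≠ 0`), the random fields `Δ n j` are a.s.
Lipschitz around `(θ*, γ*)`, and the confidence sets are uniformly consistent, then the
probability that the rank statistic is at most `r` simultaneously on the whole
confidence region tends to `1`. -/
theorem robust_test_consistency
    {Ω : Type*} [MeasurableSpace Ω] (P : Measure Ω) [IsProbabilityMeasure P]
    (d1 d2 : ℕ) (θs : EuclideanSpace ℝ (Fin d1)) (γs : EuclideanSpace ℝ (Fin d2))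
    (m : ℕ) [NeZero m]
    (Δ : ℕ → Fin m → EuclideanSpace ℝ (Fin d1) → EuclideanSpace ℝ (Fin d2) → Ω → ℝ)
    (hΔnonneg : ∀ n j θ γ ω, 0 ≤ Δ n j θ γ ω)
    (That : ℕ → Ω → Set (EuclideanSpace ℝ (Fin d1)))
    (Ghat : ℕ → Ω → Set (EuclideanSpace ℝ (Fin d2)))
    (κ : ℝ) (hκ : 0 < κ)
    (h0 : ∀ ε > (0 : ℝ),
      Tendsto (fun n => P {ω | ε < |Δ n 0 θs γs ω - κ|}) atTop (𝓝 0))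
    (hj : ∀ j : Fin m, j ≠ 0 → ∀ ε > (0 : ℝ),
      Tendsto (fun n => P {ω | ε < |Δ n j θs γs ω|}) atTop (𝓝 0))
    (hLip : ∀ᵐ ω ∂P, ∃ C > (0 : ℝ), ∃ εt > (0 : ℝ), ∀ (n : ℕ) (j : Fin m) θ γ,
      ‖θ - θs‖ ≤ εt → ‖γ - γs‖ ≤ εt →
        |Δ n j θ γ ω - Δ n j θs γs ω| ≤ C * (‖θ - θs‖ + ‖γ - γs‖))
    (hcons : ∀ ε > (0 : ℝ), ∀ᵐ ω ∂P, ∃ N0 : ℕ, ∀ n > N0,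
      That n ω ⊆ Metric.closedBall θs ε ∧ Ghat n ω ⊆ Metric.closedBall γs ε)
    (hmeas : ∀ (n r : ℕ), MeasurableSet
      {ω | ∀ θ ∈ That n ω, ∀ γ ∈ Ghat n ω, rankStat (fun j => Δ n j θ γ ω) ≤ r}) :
    ∀ r : ℕ, 1 ≤ r →
      Tendsto (fun n => P {ω | ∀ θ ∈ That n ω, ∀ γ ∈ Ghat n ω,
        rankStat (fun j => Δ n j θ γ ω) ≤ r}) atTop (𝓝 1) := by
  intro r hr
  let A : ℕ → Set Ω := fun n => {ω | κ / 4 < |Δ n 0 θs γs ω - κ|} ∪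
    ⋃ j ∈ Finset.univ.filter (fun j : Fin m => j ≠ 0), {ω | κ / 4 < |Δ n j θs γs ω|}
  have hA : Tendsto (fun n => P (A n)) atTop (𝓝 0) := by
    have hsum : Tendsto (fun n => ∑ j ∈ Finset.univ.filter (fun j : Fin m => j ≠ 0),
        P {ω | κ / 4 < |Δ n j θs γs ω|}) atTop (𝓝 0) := by
      simpa using tendsto_finsetSum (Finset.univ.filter (fun j : Fin m => j ≠ 0))
        fun j hjmem => hj j (by simpa using hjmem) (κ / 4) (by positivity)
    refine tendsto_of_tendsto_of_tendsto_of_le_of_le tendsto_const_nhds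
      (by simpa using (h0 (κ / 4) (by positivity)).add hsum) (fun _ => zero_le) fun n => ?_
    exact (measure_union_le _ _).trans (by gcongr; exact measure_biUnion_finset_le _ _)
  refine tendsto_measure_one_of_ae_eventually_mem P (fun n => hmeas n r) hA ?_
  have hcons' : ∀ᵐ ω ∂P, ∀ k : ℕ, ∃ N0 : ℕ, ∀ n > N0,
      That n ω ⊆ Metric.closedBall θs (1 / ((k : ℝ) + 1)) ∧
        Ghat n ω ⊆ Metric.closedBall γs (1 / ((k : ℝ) + 1)) :=
    ae_all_iff.2 fun k => hcons _ (by positivity)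
  filter_upwards [hLip, hcons'] with ω ⟨C, hC, εt, hεt, hbound⟩ hω
  obtain ⟨k, hk⟩ := exists_nat_one_div_lt (show 0 < min εt (κ / (16 * C)) by positivity)
  obtain ⟨N0, hN0⟩ := hω k
  filter_upwards [eventually_gt_atTop N0] with n hn hωA θ hθ γ hγ
  have hθ' : ‖θ - θs‖ < min εt (κ / (16 * C)) :=
    (mem_closedBall_iff_norm.1 ((hN0 n hn).1 hθ)).trans_lt hk
  have hγ' : ‖γ - γs‖ < min εt (κ / (16 * C)) :=
    (mem_closedBall_iff_norm.1 ((hN0 n hn).2 hγ)).trans_lt hk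
  rw [lt_min_iff, lt_div_iff₀ (by positivity)] at hθ' hγ'
  have hclose (j : Fin m) : |Δ n j θ γ ω - Δ n j θs γs ω| ≤ κ / 8 := by
    linarith [hbound n j θ γ hθ'.1.le hγ'.1.le]
  simp only [A, Set.mem_union, Set.mem_ofPred_eq, Set.mem_iUnion, Finset.mem_filter,
    Finset.mem_univ, true_and, not_or, not_exists, not_lt] at hωA
  rw [rankStat_eq_one fun j hj0 => ?_]
  · exact hr
  · have h1 := abs_le.1 hωA.1
    have h2 := abs_le.1 (hωA.2 j hj0)
    have h3 := abs_le.1 (hclose 0)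
    have h4 := abs_le.1 (hclose j)
    linarith
end

section
/- Let θ* ∈ ℝ^d and for each n let f_n : ℝ^d × Ω → ℝ be a random function and Θ̂_n : Ω → Set(ℝ^d) a nonempty random set. Assume: (i) f_n(θ*) converges in probability to a constant κ; (ii) almost surely there exist constants C > 0 and ε̃ > 0 such that for all n and all θ with ‖θ − θ*‖ ≤ ε̃: |f_n(θ) − f_n(θ*)| ≤ C‖θ − θ*‖; (iii) the sets Θ̂_n are uniformly consistent: for every ε > 0, almost surely there exists N_0 such that Θ̂_n ⊆ B(θ*, ε) for all n > N_0; (iv) the infimum and supremum of f_n over Θ̂_n are random variables. Then both inf_{θ ∈ Θ̂_n} f_n(θ) and sup_{θ ∈ Θ̂_n} f_n(θ) converge in probability to κ. -/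
open MeasureTheory Filter
open scoped ENNReal Topology

/-- A nonempty set of reals within distance `r` of `a` has its infimum and supremum within
distance `r` of `a`. -/
theorem abs_sInf_sub_le_and_abs_sSup_sub_le {S : Set ℝ} (hS : S.Nonempty) {a r : ℝ}
    (h : ∀ x ∈ S, |x - a| ≤ r) : |sInf S - a| ≤ r ∧ |sSup S - a| ≤ r := by
  have hlow : ∀ x ∈ S, a - r ≤ x := fun x hx => by linarith [(abs_le.1 (h x hx)).1]
  have hup : ∀ x ∈ S, x ≤ a + r := fun x hx => by linarith [(abs_le.1 (h x hx)).2]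
  obtain ⟨x, hx⟩ := hS
  have h1 : a - r ≤ sInf S := le_csInf ⟨x, hx⟩ hlow
  have h2 : sInf S ≤ x := csInf_le ⟨_, hlow⟩ hx
  have h3 : sSup S ≤ a + r := csSup_le ⟨x, hx⟩ hup
  have h4 : x ≤ sSup S := le_csSup ⟨_, hup⟩ hx
  have h5 := hlow x hx
  have h6 := hup x hx
  constructor <;> rw [abs_le] <;> constructor <;> linarith

/-- If `g n` converges in measure to a constant and the measurable functions `X n` satisfy
`X n - g n → 0` almost everywhere, then `X n` converges in measure to the same constant.
No measurability of `g n` is needed. -/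
theorem tendsto_measure_lt_abs_sub_of_ae_tendsto_sub {Ω : Type*} [MeasurableSpace Ω]
    (P : Measure Ω) [IsFiniteMeasure P] {g X : ℕ → Ω → ℝ} {κ : ℝ}
    (hg : ∀ ε > (0 : ℝ), Tendsto (fun n => P {ω | ε < |g n ω - κ|}) atTop (𝓝 0))
    (hX : ∀ n, Measurable (X n))
    (hXg : ∀ᵐ ω ∂P, Tendsto (fun n => X n ω - g n ω) atTop (𝓝 0)) :
    ∀ ε > (0 : ℝ), Tendsto (fun n => P {ω | ε < |X n ω - κ|}) atTop (𝓝 0) := by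
  intro ε hε
  refine tendsto_of_subseq_tendsto fun ns hns => ?_
  have hgm : TendstoInMeasure P (fun n => g (ns n)) atTop (fun _ => κ) := by
    rw [tendstoInMeasure_iff_dist]
    intro δ hδ
    refine tendsto_of_tendsto_of_tendsto_of_le_of_le tendsto_const_nhds
      ((hg (δ / 2) (half_pos hδ)).comp hns) (fun _ => zero_le) fun n => measure_mono ?_
    intro ω hω
    simp only [Set.mem_ofPred_eq, Real.dist_eq] at hω ⊢
    linarith
  obtain ⟨ms, hms, hae⟩ := hgm.exists_seq_tendsto_ae
  have hXae : ∀ᵐ ω ∂P, Tendsto (fun k => X (ns (ms k)) ω) atTop (𝓝 κ) := by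
    filter_upwards [hae, hXg] with ω h1 h2
    simpa using (h2.comp (hns.comp hms.tendsto_atTop)).add h1
  have hXm := tendstoInMeasure_of_tendsto_ae
    (fun k => (hX (ns (ms k))).aestronglyMeasurable) hXae
  rw [tendstoInMeasure_iff_dist] at hXm
  exact ⟨ms, tendsto_of_tendsto_of_tendsto_of_le_of_le tendsto_const_nhds (hXm ε hε)
    (fun _ => zero_le) fun k => measure_mono fun ω hω => (show ε < dist _ _ from hω).le⟩

/-- If `f n (θ*)` converges in probability to a constant `κ`, the random functions
`f n` are a.s. Lipschitz around `θ*`, and the nonempty random sets `Θ̂ n` are uniformly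
consistent (eventually contained in any ball around `θ*`), then both the infimum and
the supremum of `f n` over `Θ̂ n` converge in probability to `κ`. -/
theorem inf_sup_over_confidence_sets_tendsto
    {Ω : Type*} [MeasurableSpace Ω] (P : Measure Ω) [IsProbabilityMeasure P]
    (d : ℕ) (θs : EuclideanSpace ℝ (Fin d))
    (f : ℕ → EuclideanSpace ℝ (Fin d) → Ω → ℝ)
    (That : ℕ → Ω → Set (EuclideanSpace ℝ (Fin d)))
    (hne : ∀ n ω, (That n ω).Nonempty)
    (κ : ℝ)
    (h0 : ∀ ε > (0 : ℝ),
      Tendsto (fun n => P {ω | ε < |f n θs ω - κ|}) atTop (𝓝 0))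
    (hLip : ∀ᵐ ω ∂P, ∃ C > (0 : ℝ), ∃ εt > (0 : ℝ), ∀ (n : ℕ) θ,
      ‖θ - θs‖ ≤ εt → |f n θ ω - f n θs ω| ≤ C * ‖θ - θs‖)
    (hcons : ∀ ε > (0 : ℝ), ∀ᵐ ω ∂P, ∃ N0 : ℕ, ∀ n > N0,
      That n ω ⊆ Metric.closedBall θs ε)
    (hinfmeas : ∀ n, Measurable (fun ω => sInf ((fun θ => f n θ ω) '' That n ω)))
    (hsupmeas : ∀ n, Measurable (fun ω => sSup ((fun θ => f n θ ω) '' That n ω))) :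
    (∀ ε > (0 : ℝ), Tendsto
      (fun n => P {ω | ε < |sInf ((fun θ => f n θ ω) '' That n ω) - κ|}) atTop (𝓝 0)) ∧
    (∀ ε > (0 : ℝ), Tendsto
      (fun n => P {ω | ε < |sSup ((fun θ => f n θ ω) '' That n ω) - κ|}) atTop (𝓝 0)) := by
  have hcons' : ∀ᵐ ω ∂P, ∀ k : ℕ, ∃ N0 : ℕ, ∀ n > N0,
      That n ω ⊆ Metric.closedBall θs (1 / ((k : ℝ) + 1)) :=
    ae_all_iff.2 fun k => hcons _ Nat.one_div_pos_of_nat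
  have key : ∀ᵐ ω ∂P, ∀ ε > (0 : ℝ), ∀ᶠ n in atTop,
      |sInf ((fun θ => f n θ ω) '' That n ω) - f n θs ω| ≤ ε ∧
      |sSup ((fun θ => f n θ ω) '' That n ω) - f n θs ω| ≤ ε := by
    filter_upwards [hLip, hcons'] with ω ⟨C, hC, εt, hεt, hf⟩ hN ε hε
    obtain ⟨k, hk⟩ := exists_nat_one_div_lt (lt_min hεt (div_pos hε hC))
    obtain ⟨N, hN⟩ := hN k
    filter_upwards [eventually_gt_atTop N] with n hn
    refine abs_sInf_sub_le_and_abs_sSup_sub_le ((hne n ω).image _) ?_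
    rintro _ ⟨θ, hθ, rfl⟩
    have hθk : ‖θ - θs‖ < min εt (ε / C) :=
      (mem_closedBall_iff_norm.1 (hN n hn hθ)).trans_lt hk
    calc |f n θ ω - f n θs ω| ≤ C * ‖θ - θs‖ := hf n θ (hθk.le.trans (min_le_left _ _))
      _ ≤ C * (ε / C) := by gcongr; exact hθk.le.trans (min_le_right _ _)
      _ = ε := mul_div_cancel₀ ε hC.ne'
  constructor
  · refine tendsto_measure_lt_abs_sub_of_ae_tendsto_sub P h0 hinfmeas ?_
    filter_upwards [key] with ω h
    refine Metric.tendsto_nhds.2 fun ε hε => (h (ε / 2) (half_pos hε)).mono fun n hn => ?_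
    rw [Real.dist_eq, sub_zero]
    exact hn.1.trans_lt (half_lt_self hε)
  · refine tendsto_measure_lt_abs_sub_of_ae_tendsto_sub P h0 hsupmeas ?_
    filter_upwards [key] with ω h
    refine Metric.tendsto_nhds.2 fun ε hε => (h (ε / 2) (half_pos hε)).mono fun n hn => ?_
    rw [Real.dist_eq, sub_zero]
    exact hn.2.trans_lt (half_lt_self hε)
end

section
/- Let k, ℓ : ℝ × ℝ → ℝ and L > 0 be such that the product kernel is L-Lipschitz with respect to the ℓ1 metric, i.e. for all x_1, x_2, y_1, y_2, x_1', x_2', y_1', y_2' ∈ ℝ: |k(x_1, x_2)ℓ(y_1, y_2) − k(x_1', x_2')ℓ(y_1', y_2')| ≤ L(|x_1 − x_1'| + |x_2 − x_2'| + |y_1 − y_1'| + |y_2 − y_2'|). For data (e, ν) = ((e_1, ν_1), …, (e_n, ν_n)) define the empirical HSIC by HSIC_n(e, ν) = (1/n²) Σ_{i,j} k(e_i, e_j)ℓ(ν_i, ν_j) + (1/n⁴) Σ_{i,j,r,s} k(e_i, e_j)ℓ(ν_r, ν_s) − (2/n³) Σ_{i,j,s} k(e_i, e_j)ℓ(ν_i,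 ν_s). Then for any two datasets (e, ν) and (e', ν') of size n: |HSIC_n(e, ν) − HSIC_n(e', ν')| ≤ 8L · ((1/n) Σ_{i=1}^{n} |e_i − e_i'| + (1/n) Σ_{i=1}^{n} |ν_i − ν_i'|). -/
/-- The empirical (V-statistic) estimate of the Hilbert–Schmidt independence criterion
associated with kernels `k` and `l`, computed from the bivariate sample
`(e 0, ν 0), …, (e (n−1), ν (n−1))`. -/
noncomputable def empHSIC (n : ℕ) (k l : ℝ → ℝ → ℝ) (e ν : Fin n → ℝ) : ℝ :=
  (∑ i : Fin n, ∑ j : Fin n, k (e i) (e j) * l (ν i) (ν j)) / (n : ℝ) ^ 2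
    + (∑ i : Fin n, ∑ j : Fin n, ∑ r : Fin n, ∑ s : Fin n,
        k (e i) (e j) * l (ν r) (ν s)) / (n : ℝ) ^ 4
    - 2 * (∑ i : Fin n, ∑ j : Fin n, ∑ s : Fin n,
        k (e i) (e j) * l (ν i) (ν s)) / (n : ℝ) ^ 3

/-- The difference of two finite sums is controlled termwise. -/
theorem abs_sum_sub_sum_le {ι : Type*} (s : Finset ι) {f g b : ι → ℝ}
    (h : ∀ i ∈ s, |f i - g i| ≤ b i) : |∑ i ∈ s, f i - ∑ i ∈ s, g i| ≤ ∑ i ∈ s, b i := by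
  rw [← Finset.sum_sub_distrib]
  exact (Finset.abs_sum_le_sum_abs _ _).trans (Finset.sum_le_sum h)

/-- Dividing a bound on the difference of two sums over `n ^ (m + 1)` tuples by their number. -/
theorem abs_div_pow_sub_le {n S T c : ℝ} (hn : 0 < n) (m : ℕ)
    (h : |S - T| ≤ n ^ m * c) : |S / n ^ (m + 1) - T / n ^ (m + 1)| ≤ c / n := by
  rw [← sub_div, abs_div, abs_of_pos (pow_pos hn _), div_le_div_iff₀ (pow_pos hn _) hn]
  calc |S - T| * n ≤ n ^ m * c * n := by gcongr
    _ = c * n ^ (m + 1) := by ring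

/-- Perturbation bound for the combination `a + b - 2 * c`. -/
theorem abs_add_sub_two_mul_sub_le {a b c a' b' c' d : ℝ}
    (ha : |a - a'| ≤ d) (hb : |b - b'| ≤ d) (hc : |c - c'| ≤ d) :
    |a + b - 2 * c - (a' + b' - 2 * c')| ≤ 4 * d := by
  rw [abs_le] at *
  constructor <;> linarith

/-- If the product kernel `k ⊗ l` is `L`-Lipschitz with respect to the `ℓ¹` metric,
then the empirical HSIC is Lipschitz in the data with respect to the normalized `ℓ¹`
(Cesàro-type) metric, with constant `8 L`. -/
theorem empHSIC_lipschitz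
    (k l : ℝ → ℝ → ℝ) (L : ℝ) (hL : 0 < L)
    (hLip : ∀ x1 x2 y1 y2 x1' x2' y1' y2' : ℝ,
      |k x1 x2 * l y1 y2 - k x1' x2' * l y1' y2'| ≤
        L * (|x1 - x1'| + |x2 - x2'| + |y1 - y1'| + |y2 - y2'|))
    (n : ℕ) (e ν e' ν' : Fin n → ℝ) :
    |empHSIC n k l e ν - empHSIC n k l e' ν'| ≤
      8 * L * ((∑ i : Fin n, |e i - e' i|) / (n : ℝ)
        + (∑ i : Fin n, |ν i - ν' i|) / (n : ℝ)) := by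
  rcases n.eq_zero_or_pos with rfl | hpos
  · simp [empHSIC]
  have hn : (0 : ℝ) < n := Nat.cast_pos.mpr hpos
  set A := ∑ i : Fin n, |e i - e' i| with hA
  set B := ∑ i : Fin n, |ν i - ν' i| with hB
  have h₂ := abs_div_pow_sub_le (c := 2 * L * (A + B)) hn 1 <|
    (abs_sum_sub_sum_le Finset.univ fun i _ ↦ abs_sum_sub_sum_le Finset.univ fun j _ ↦
      hLip (e i) (e j) (ν i) (ν j) (e' i) (e' j) (ν' i) (ν' j)).trans_eq (by
        simp only [← Finset.mul_sum, Finset.sum_add_distrib, Finset.sum_const,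
          Finset.card_univ, Fintype.card_fin, nsmul_eq_mul, ← hA, ← hB]
        ring)
  have h₄ := abs_div_pow_sub_le (c := 2 * L * (A + B)) hn 3 <|
    (abs_sum_sub_sum_le Finset.univ fun i _ ↦ abs_sum_sub_sum_le Finset.univ fun j _ ↦
      abs_sum_sub_sum_le Finset.univ fun r _ ↦ abs_sum_sub_sum_le Finset.univ fun s _ ↦
      hLip (e i) (e j) (ν r) (ν s) (e' i) (e' j) (ν' r) (ν' s)).trans_eq (by
        simp only [← Finset.mul_sum, Finset.sum_add_distrib, Finset.sum_const,
          Finset.card_univ, Fintype.card_fin, nsmul_eq_mul, ← hA, ← hB]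
        ring)
  have h₃ := abs_div_pow_sub_le (c := 2 * L * (A + B)) hn 2 <|
    (abs_sum_sub_sum_le Finset.univ fun i _ ↦ abs_sum_sub_sum_le Finset.univ fun j _ ↦
      abs_sum_sub_sum_le Finset.univ fun s _ ↦
      hLip (e i) (e j) (ν i) (ν s) (e' i) (e' j) (ν' i) (ν' s)).trans_eq (by
        simp only [← Finset.mul_sum, Finset.sum_add_distrib, Finset.sum_const,
          Finset.card_univ, Fintype.card_fin, nsmul_eq_mul, ← hA, ← hB]
        ring)
  have hc : 8 * L * (A / n + B / n) = 4 * (2 * L * (A + B) / n) := by ring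
  rw [hc]
  simp only [empHSIC, mul_div_assoc (2 : ℝ) (Finset.sum _ _)]
  exact abs_add_sub_two_mul_sub_le h₂ h₄ h₃
end
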